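/- arXiv:1803.01735 — 2 statements merged into one kernel-verified Lean document; each statement's English description precedes it below -/
import Mathlib

section
/- For 0 ≤ i ≤ n, the dual Bernstein polynomial D^n_i(x; α, β) satisfies the second-order non-homogeneous differential equation x(x-1) y'' + ((n+σ+3)x - i - β - 2) y' + (n+σ+1) y = (n+σ+1) A^{(α,β)}_{ni} R^{(α+1,β+1)}_n(x), where σ = α+β+1 and A^{(α,β)}_{ni} = (-1)^{n-i}(n+1)(σ+1)_n / (K (α+1)_{n-i} (β+1)_i) with K = Γ(α+1)Γ(β+1)/Γ(σ+1). -/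
open scoped BigOperators
open MeasureTheory Polynomial

/-- Pochhammer symbol `(c)_l = c (c+1) ⋯ (c+l-1)`. -/
noncomputable def poch (c : ℝ) (l : ℕ) : ℝ := ∏ j ∈ Finset.range l, (c + j)

/-- Shifted Jacobi polynomial `R_k^{(α,β)}(x)`. -/
noncomputable def jacobiR (α β : ℝ) (k : ℕ) (x : ℝ) : ℝ :=
  poch (α + 1) k / (Nat.factorial k) *
    ∑ l ∈ Finset.range (k + 1),
      poch (-(k : ℝ)) l * poch ((k : ℝ) + α + β + 1) l /
        (poch (α + 1) l * (Nat.factorial l)) * (1 - x) ^ l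

/-- Hahn polynomial `Q_k(x; α, β; N)`. -/
noncomputable def hahnQ (α β : ℝ) (N k : ℕ) (x : ℝ) : ℝ :=
  ∑ l ∈ Finset.range (k + 1),
    poch (-(k : ℝ)) l * poch ((k : ℝ) + α + β + 1) l * poch (-x) l /
      (poch (α + 1) l * poch (-(N : ℝ)) l * (Nat.factorial l))

/-- Bernstein basis polynomial `B^n_i(x)` as a real function. -/
noncomputable def bern (n i : ℕ) (x : ℝ) : ℝ :=
  (n.choose i : ℝ) * x ^ i * (1 - x) ^ (n - i)

/-- `D 0, …, D n` are the dual Bernstein polynomials of degree `n` with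
parameters `α, β`: they have degree at most `n` and are biorthogonal to the
Bernstein basis w.r.t. the weight `(1-x)^α x^β` on `[0,1]`. -/
def IsDualBernstein (n : ℕ) (α β : ℝ) (D : ℕ → Polynomial ℝ) : Prop :=
  (∀ j, j ≤ n → (D j).natDegree ≤ n) ∧
  ∀ i, i ≤ n → ∀ j, j ≤ n →
    (∫ x in (0:ℝ)..1, (1 - x) ^ α * x ^ β * bern n i x * (D j).eval x)
      = if i = j then (1:ℝ) else 0


lemma poch_succ (c : ℝ) (l : ℕ) : poch c (l+1) = poch c l * (c + l) := by
  simp [poch, Finset.prod_range_succ]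

lemma poch_zero (c : ℝ) : poch c 0 = 1 := by simp [poch]

lemma poch_add (c : ℝ) (a b : ℕ) : poch c (a+b) = poch c a * poch (c+a) b := by
  induction b with
  | zero => simp [poch_zero]
  | succ b ih => rw [← add_assoc, poch_succ, ih, poch_succ]; push_cast; ring

lemma poch_pos {c : ℝ} (hc : 0 < c) (l : ℕ) : 0 < poch c l :=
  Finset.prod_pos fun j _ => by positivity

lemma poch_neg (n l : ℕ) (h : l ≤ n) :
    poch (-(n:ℝ)) l = (-1)^l * (n.choose l : ℝ) * (l.factorial : ℝ) := by
  induction l with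
  | zero => simp [poch_zero]
  | succ l ih =>
    rw [poch_succ, ih (by omega)]
    have h1 := Nat.choose_succ_right_eq n l
    have h2 : (n.choose (l+1) : ℝ) * (l+1) = n.choose l * (n - l) := by
      have := congrArg (Nat.cast (R := ℝ)) h1
      push_cast [Nat.cast_sub (show l ≤ n by omega)] at this
      exact this
    rw [Nat.factorial_succ]; push_cast
    linear_combination ((-1)^l * (l.factorial:ℝ)) * h2

lemma Gamma_poch {s : ℝ} (hs : 0 < s) (n : ℕ) :
    Real.Gamma (s + n) = poch s n * Real.Gamma s := by
  induction n with
  | zero => simp [poch_zero]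
  | succ n ih =>
    have : s + ((n+1 : ℕ):ℝ) = (s + n) + 1 := by push_cast; ring
    rw [this, Real.Gamma_add_one (by positivity), ih, poch_succ]; ring

/-- Polynomial version of the Pochhammer symbol. -/
noncomputable def pochPoly (c : ℝ) (k : ℕ) : ℝ[X] := ∏ j ∈ Finset.range k, (X + C (c + j))

lemma pochPoly_eval (c : ℝ) (k : ℕ) (x : ℝ) : (pochPoly c k).eval x = poch (c + x) k := by
  simp only [pochPoly, poch, eval_prod, eval_add, eval_X, eval_C]
  exact Finset.prod_congr rfl fun j _ => by ring

lemma pochPoly_monic (c : ℝ) (k : ℕ) : (pochPoly c k).Monic :=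
  monic_prod_of_monic _ _ fun _ _ => monic_X_add_C _

lemma pochPoly_natDegree (c : ℝ) (k : ℕ) : (pochPoly c k).natDegree = k := by
  rw [pochPoly, natDegree_prod_of_monic _ _ fun _ _ => monic_X_add_C _]
  simp only [natDegree_X_add_C]; simp

lemma altsum_eq (P : ℝ[X]) (n : ℕ) :
    ∑ k ∈ Finset.range (n+1), (-1:ℝ)^(n-k) * (n.choose k : ℝ) * P.eval (k:ℝ)
      = (fwdDiff (1:ℝ))^[n] P.eval 0 := by
  rw [fwdDiff_iter_eq_sum_shift]
  exact Finset.sum_congr rfl fun k _ => by simp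

lemma altsum_zero (P : ℝ[X]) (n : ℕ) (h : P.natDegree < n) :
    ∑ k ∈ Finset.range (n+1), (-1:ℝ)^(n-k) * (n.choose k : ℝ) * P.eval (k:ℝ) = 0 := by
  rw [altsum_eq, Polynomial.fwdDiff_iter_eq_zero_of_degree_lt h]; rfl

lemma altsum_zero' (P : ℝ[X]) (n : ℕ) (h : P.natDegree < n) :
    ∑ k ∈ Finset.range (n+1), (-1:ℝ)^k * (n.choose k : ℝ) * P.eval (k:ℝ) = 0 := by
  have h1 := altsum_zero P n h
  have : ∑ k ∈ Finset.range (n+1), (-1:ℝ)^k * (n.choose k : ℝ) * P.eval (k:ℝ)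
    = (-1)^n * ∑ k ∈ Finset.range (n+1), (-1:ℝ)^(n-k) * (n.choose k : ℝ) * P.eval (k:ℝ) := by
    rw [Finset.mul_sum]
    refine Finset.sum_congr rfl fun k hk => ?_
    have hk' : k ≤ n := by simpa [Nat.lt_succ_iff] using hk
    obtain ⟨m, rfl⟩ := Nat.exists_eq_add_of_le hk'
    have e : (-1:ℝ)^m * (-1)^m = 1 := by rw [← mul_pow]; simp
    rw [Nat.add_sub_cancel_left, pow_add]
    linear_combination -((-1:ℝ)^k * ((k+m).choose k : ℝ) * P.eval (k:ℝ)) * e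
  rw [this, h1, mul_zero]

lemma altsum_fact (P : ℝ[X]) (n : ℕ) (hm : P.Monic) (h : P.natDegree = n) :
    ∑ k ∈ Finset.range (n+1), (-1:ℝ)^(n-k) * (n.choose k : ℝ) * P.eval (k:ℝ) = n.factorial := by
  rw [altsum_eq]; subst h
  rw [Polynomial.fwdDiff_iter_degree_eq_factorial, hm.leadingCoeff]
  simp

/-! ### The weighted integral -/

lemma wt_integrable {α β : ℝ} (hα : -1 < α) (hβ : -1 < β) :
    IntervalIntegrable (fun x : ℝ => (1-x)^α * x^β) volume 0 1 := by
  have h := Complex.betaIntegral_convergent (u := ((β+1 : ℝ):ℂ)) (v := ((α+1:ℝ):ℂ))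
    (by simp; linarith) (by simp; linarith)
  rw [intervalIntegrable_iff_integrableOn_Ioc_of_le (by simp)] at h ⊢
  refine IntegrableOn.congr_fun (f := fun x : ℝ => RCLike.re ((x:ℂ) ^ (((β+1:ℝ):ℂ) - 1) * (1 - (x:ℂ)) ^ (((α+1:ℝ):ℂ) - 1)))
    (Integrable.re h) (fun x hx => ?_) measurableSet_Ioc
  obtain ⟨h0, h1⟩ := hx
  simp only [Complex.ofReal_add, Complex.ofReal_one, add_sub_cancel_right]
  rw [← Complex.ofReal_cpow h0.le, ← Complex.ofReal_one, ← Complex.ofReal_sub,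
    ← Complex.ofReal_cpow (by linarith), ← Complex.ofReal_mul]
  simp [mul_comm]

lemma wt_integral {α β : ℝ} (hα : -1 < α) (hβ : -1 < β) :
    ∫ x in (0:ℝ)..1, (1-x)^α * x^β
      = Real.Gamma (α+1) * Real.Gamma (β+1) / Real.Gamma (α+β+2) := by
  have h := ProbabilityTheory.beta_eq_betaIntegralReal (β+1) (α+1) (by linarith) (by linarith)
  rw [ProbabilityTheory.beta] at h
  have e : Complex.betaIntegral ((β+1 : ℝ):ℂ) ((α+1:ℝ):ℂ)
      = ((∫ x in (0:ℝ)..1, (1-x)^α * x^β : ℝ) : ℂ) := by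
    rw [Complex.betaIntegral, ← intervalIntegral.integral_ofReal]
    refine intervalIntegral.integral_congr fun x hx => ?_
    rw [Set.uIcc_of_le (by norm_num)] at hx
    obtain ⟨h0, h1⟩ := hx
    simp only [Complex.ofReal_add, Complex.ofReal_one, add_sub_cancel_right]
    rw [← Complex.ofReal_cpow h0, ← Complex.ofReal_one, ← Complex.ofReal_sub,
      ← Complex.ofReal_cpow (by linarith), ← Complex.ofReal_mul, mul_comm]
  rw [e, Complex.ofReal_re] at h
  rw [← h]
  rw [show β + 1 + (α + 1) = α + β + 2 by ring, mul_comm (Real.Gamma (α+1))]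

lemma wt_poly_integrable {α β : ℝ} (hα : -1 < α) (hβ : -1 < β) (p : ℝ[X]) :
    IntervalIntegrable (fun x : ℝ => (1-x)^α * x^β * p.eval x) volume 0 1 :=
  (wt_integrable hα hβ).mul_continuousOn p.continuous.continuousOn

/-- The linear functional given by integration against the weight. -/
noncomputable def wtM {α β : ℝ} (hα : -1 < α) (hβ : -1 < β) : ℝ[X] →ₗ[ℝ] ℝ where
  toFun p := ∫ x in (0:ℝ)..1, (1-x)^α * x^β * p.eval x
  map_add' p q := by
    rw [← intervalIntegral.integral_add (wt_poly_integrable hα hβ p) (wt_poly_integrable hα hβ q)]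
    simp [mul_add]
  map_smul' c p := by
    simp only [RingHom.id_apply, smul_eq_mul]
    rw [← intervalIntegral.integral_const_mul]
    refine intervalIntegral.integral_congr fun x _ => ?_
    simp; ring

lemma wtM_apply {α β : ℝ} (hα : -1 < α) (hβ : -1 < β) (p : ℝ[X]) :
    wtM hα hβ p = ∫ x in (0:ℝ)..1, (1-x)^α * x^β * p.eval x := rfl

lemma wtM_moment {α β : ℝ} (hα : -1 < α) (hβ : -1 < β) (a b : ℕ) :
    wtM hα hβ (X^a * (1-X)^b) =
      (Real.Gamma (α+1) * Real.Gamma (β+1) / Real.Gamma (α+β+2)) * poch (β+1) a * poch (α+1) b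
        / poch (α+β+2) (a+b) := by
  have h1 : wtM hα hβ (X^a * (1-X)^b) = ∫ x in (0:ℝ)..1, (1-x)^(α+b) * x^(β+a) := by
    rw [wtM_apply]
    refine intervalIntegral.integral_congr_ae ?_
    have : ∀ᵐ x : ℝ ∂volume, x ≠ 1 := by simp [ae_iff]
    filter_upwards [this] with x hx1 hx
    rw [Set.uIoc_of_le (by norm_num)] at hx
    have h0 : 0 < x := hx.1
    have h1 : 0 < 1 - x := by
      have := lt_of_le_of_ne hx.2 hx1
      linarith
    rw [Real.rpow_add h0, Real.rpow_add h1, Real.rpow_natCast, Real.rpow_natCast]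
    simp; ring
  have pa : (0:ℝ) ≤ a := by positivity
  have pb : (0:ℝ) ≤ b := by positivity
  rw [h1, wt_integral (by linarith) (by linarith)]
  rw [show α + b + 1 = (α+1) + b by ring, show β + a + 1 = (β+1)+a by ring,
    show α + b + (β + a) + 2 = (α+β+2) + ((a+b : ℕ):ℝ) by push_cast; ring,
    Gamma_poch (by linarith), Gamma_poch (by linarith), Gamma_poch (by linarith)]
  have := (poch_pos (show 0 < α+β+2 by linarith) (a+b)).ne'
  have := (Real.Gamma_pos_of_pos (show 0 < α+β+2 by linarith)).ne'
  field_simp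

lemma wtM_pos {α β : ℝ} (hα : -1 < α) (hβ : -1 < β) (r : ℝ[X])
    (h : wtM hα hβ (X * (1-X) * (r*r)) = 0) : r = 0 := by
  by_contra hr
  have h1 : wtM hα hβ (X * (1-X) * (r*r)) =
      ∫ x in (0:ℝ)..1, (1-x)^(α+1) * x^(β+1) * (r.eval x)^2 := by
    rw [wtM_apply]
    refine intervalIntegral.integral_congr_ae ?_
    have : ∀ᵐ x : ℝ ∂volume, x ≠ 1 := by simp [ae_iff]
    filter_upwards [this] with x hx1 hx
    rw [Set.uIoc_of_le (by norm_num)] at hx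
    have h0 : 0 < x := hx.1
    have h1 : 0 < 1 - x := by
      have := lt_of_le_of_ne hx.2 hx1
      linarith
    rw [Real.rpow_add h0, Real.rpow_add h1, Real.rpow_one, Real.rpow_one]
    simp; ring
  have hpos : 0 < ∫ x in (0:ℝ)..1, (1-x)^(α+1) * x^(β+1) * (r.eval x)^2 := by
    refine intervalIntegral.integral_pos (by norm_num) ?_ ?_ ?_
    · refine ContinuousOn.mul (ContinuousOn.mul ?_ ?_) ?_
      · exact ContinuousOn.rpow_const (by fun_prop) fun x _ => Or.inr (by linarith)
      · exact ContinuousOn.rpow_const (by fun_prop) fun x _ => Or.inr (by linarith)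
      · exact (r.continuous.pow 2).continuousOn
    · intro x hx
      have := hx.1
      have : 0 ≤ 1 - x := by linarith [hx.2]
      have := hx.1.le
      positivity
    · have hinf : (Set.Ioo (0:ℝ) 1 \ (r.rootSet ℝ)).Nonempty :=
        ((Set.Ioo_infinite (by norm_num)).sdiff (r.rootSet_finite ℝ)).nonempty
      obtain ⟨x, ⟨hx0, hx1⟩, hxr⟩ := hinf
      refine ⟨x, ⟨hx0.le, hx1.le⟩, ?_⟩
      have : r.eval x ≠ 0 := fun h0 => hxr (by simp [mem_rootSet, hr, h0])
      have : 0 < 1 - x := by linarith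
      positivity
  linarith

/-! ### Algebraic consequences of the moment formula -/

lemma X_mul_derivative_X_pow (a : ℕ) :
    (X:ℝ[X]) * derivative (X^a) = (a:ℝ[X]) * X^a := by
  cases a with
  | zero => simp
  | succ a => rw [derivative_X_pow]; simp [pow_succ]; ring

lemma one_sub_mul_derivative_pow (b : ℕ) :
    (1 - X:ℝ[X]) * derivative ((1-X)^b) = -(b:ℝ[X]) * (1-X)^b := by
  cases b with
  | zero => simp
  | succ b => rw [derivative_pow]; simp [pow_succ]; ring

/-- The first-order operator of the Pearson equation. -/
noncomputable def pearson (α β : ℝ) (f : ℝ[X]) : ℝ[X] :=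
  X * (1-X) * derivative f + (C (β+1) - C (α+β+2) * X) * f

lemma wtM_pearson {α β : ℝ} (hα : -1 < α) (hβ : -1 < β) (f : ℝ[X]) :
    wtM hα hβ (pearson α β f) = 0 := by
  induction f using Polynomial.induction_on' with
  | add p q hp hq =>
    have : pearson α β (p+q) = pearson α β p + pearson α β q := by
      simp only [pearson, derivative_add]; ring
    rw [this, map_add, hp, hq, add_zero]
  | monomial a c =>
    have h0 := wtM_moment hα hβ a 0
    have h1 := wtM_moment hα hβ (a+1) 0
    simp only [pow_zero, mul_one, add_zero, poch_succ, poch_zero] at h0 h1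
    have : pearson α β (monomial a c)
        = (c * (a + (β+1))) • (X^a : ℝ[X]) - (c * (a + (α+β+2))) • (X^(a+1) : ℝ[X]) := by
      rw [← C_mul_X_pow_eq_monomial]
      simp only [pearson, derivative_C_mul, smul_eq_C_mul, C_mul, C_add, map_natCast]
      linear_combination (1-X) * C c * X_mul_derivative_X_pow a
    rw [this, map_sub, map_smul, map_smul, h0, h1]
    have h2 := (poch_pos (show 0 < α+β+2 by linarith) a).ne'
    have pa : (0:ℝ) ≤ a := by positivity
    have h3 : α+β+2+(a:ℝ) ≠ 0 := by
      have : 0 < α+β+2+(a:ℝ) := by linarith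
      exact this.ne'
    simp only [smul_eq_mul]
    field_simp
    ring

lemma bernstein_span (n : ℕ) (F : ℝ[X] →ₗ[ℝ] ℝ)
    (h : ∀ j, j ≤ n → F (X^j * (1-X)^(n-j)) = 0) (q : ℝ[X]) (hq : q.natDegree ≤ n) :
    F q = 0 := by
  have hX : ∀ k, k ≤ n → F (X^k) = 0 := by
    intro k hk
    have e : (X^k : ℝ[X]) = ∑ m ∈ Finset.range (n-k+1),
        ((n-k).choose m : ℝ) • (X^(k+m) * (1-X)^(n-(k+m))) := by
      have := add_pow (X:ℝ[X]) (1-X) (n-k)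
      rw [add_sub_cancel, one_pow] at this
      calc (X^k:ℝ[X]) = X^k * 1 := by ring
        _ = _ := by
          conv_lhs => rw [this, Finset.mul_sum]
          refine Finset.sum_congr rfl fun m _ => ?_
          rw [smul_eq_C_mul, map_natCast, Nat.sub_sub]; ring
    rw [e, map_sum]
    refine Finset.sum_eq_zero fun m hm => ?_
    have := Finset.mem_range.1 hm
    rw [map_smul, h _ (by omega), smul_zero]
  rw [q.as_sum_range_C_mul_X_pow, map_sum]
  refine Finset.sum_eq_zero fun k hk => ?_
  have := Finset.mem_range.1 hk
  rw [← smul_eq_C_mul, map_smul, hX k (by omega), smul_zero]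

lemma one_sub_span (n : ℕ) (F : ℝ[X] →ₗ[ℝ] ℝ)
    (h : ∀ m, m < n → F ((1-X)^m) = 0) (q : ℝ[X]) (hq : q.natDegree < n) :
    F q = 0 := by
  have e : q = (q.comp (1-X)).comp (1-X) := by
    rw [comp_assoc]; simp
  have hd : (q.comp (1-X)).natDegree ≤ q.natDegree := by
    refine natDegree_comp_le.trans ?_
    have : (1 - X : ℝ[X]).natDegree ≤ 1 := by
      refine (natDegree_sub_le _ _).trans ?_
      simp
    nlinarith
  rw [e, comp_eq_sum_left, sum_over_range _ (by simp), map_sum]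
  refine Finset.sum_eq_zero fun k hk => ?_
  have := Finset.mem_range.1 hk
  rw [← smul_eq_C_mul, map_smul, h k (by omega), smul_zero]

/-- Polynomial version of `jacobiR`. -/
noncomputable def jacP (α β : ℝ) (k : ℕ) : ℝ[X] :=
  C (poch (α + 1) k / (Nat.factorial k)) *
    ∑ l ∈ Finset.range (k + 1),
      C (poch (-(k : ℝ)) l * poch ((k : ℝ) + α + β + 1) l /
        (poch (α + 1) l * (Nat.factorial l))) * (1 - X) ^ l

lemma jacP_eval (α β : ℝ) (k : ℕ) (x : ℝ) : (jacP α β k).eval x = jacobiR α β k x := by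
  simp [jacP, jacobiR, eval_finsetSum]

lemma natDegree_one_sub_pow (l : ℕ) : ((1 - X : ℝ[X])^l).natDegree ≤ l := by
  refine natDegree_pow_le.trans ?_
  have : (1 - X : ℝ[X]).natDegree ≤ 1 := by
    refine (natDegree_sub_le _ _).trans ?_
    simp
  nlinarith

lemma coeff_one_sub_pow (l : ℕ) : ((1 - X : ℝ[X])^l).coeff l = (-1)^l := by
  have h := coeff_pow_of_natDegree_le (p := (1 - X : ℝ[X])) (n := 1) (m := l)
    (by simpa using natDegree_one_sub_pow 1)
  simpa [coeff_one] using h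

lemma jacP_natDegree (α β : ℝ) (k : ℕ) : (jacP α β k).natDegree ≤ k := by
  refine (natDegree_C_mul_le _ _).trans (natDegree_sum_le_of_forall_le _ _ fun l hl => ?_)
  have := Finset.mem_range.1 hl
  exact (natDegree_C_mul_le _ _).trans ((natDegree_one_sub_pow l).trans (by omega))

lemma jacP_coeff (α β : ℝ) (hα : -1 < α) (k : ℕ) :
    (jacP α β k).coeff k = poch ((k:ℝ) + α + β + 1) k / k.factorial := by
  rw [jacP, coeff_C_mul, finsetSum_coeff, Finset.sum_range_succ, Finset.sum_eq_zero, zero_add,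
    coeff_C_mul, coeff_one_sub_pow, poch_neg k k le_rfl]
  · have h1 := (poch_pos (show 0 < α+1 by linarith) k).ne'
    have h2 : (k.factorial:ℝ) ≠ 0 := by positivity
    have e : (-1:ℝ)^k * (-1)^k = 1 := by rw [← mul_pow]; simp
    field_simp
    simp only [Nat.choose_self, Nat.cast_one, mul_one]
    linear_combination (poch ((k:ℝ) + α + β + 1) k) * e
  · intro l hl
    have := Finset.mem_range.1 hl
    rw [coeff_C_mul, coeff_eq_zero_of_natDegree_lt ((natDegree_one_sub_pow l).trans_lt this),
      mul_zero]

lemma jacP_orth {α β : ℝ} (hα : -1 < α) (hβ : -1 < β) (n : ℕ) (p : ℝ[X])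
    (hp : p.natDegree < n) :
    wtM hα hβ (X * (1-X) * (p * jacP (α+1) (β+1) n)) = 0 := by
  have key := one_sub_span n ((wtM hα hβ).comp
    (LinearMap.mulRight ℝ (X * (1-X) * jacP (α+1) (β+1) n))) ?_ p hp
  · simp only [LinearMap.comp_apply, LinearMap.mulRight_apply] at key
    rw [← key]; congr 1; ring
  intro m hm
  simp only [LinearMap.comp_apply, LinearMap.mulRight_apply]
  obtain ⟨d, rfl⟩ := Nat.exists_eq_add_of_lt hm
  set n := m + d + 1 with hn
  set s := α + β + 2 with hs
  set K := Real.Gamma (α+1) * Real.Gamma (β+1) / Real.Gamma s with hK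
  have s0 : 0 < s := by linarith
  set P : ℝ[X] := pochPoly (α+2) m * pochPoly (s+m+2) d with hP
  have hPd : P.natDegree < n := by
    refine natDegree_mul_le.trans_lt ?_
    rw [pochPoly_natDegree, pochPoly_natDegree]; omega
  have e : (1-X)^m * (X * (1-X) * jacP (α+1) (β+1) n)
      = (poch (α + 1 + 1) n / (Nat.factorial n)) • ∑ l ∈ Finset.range (n + 1),
        (poch (-(n : ℝ)) l * poch ((n : ℝ) + (α+1) + (β+1) + 1) l /
        (poch (α + 1 + 1) l * (Nat.factorial l))) • (X^1 * (1 - X : ℝ[X]) ^ (l+m+1)) := by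
    simp only [jacP, smul_eq_C_mul, Finset.mul_sum]
    refine Finset.sum_congr rfl fun l _ => ?_
    ring
  rw [e, map_smul, map_sum]
  have e2 : ∀ l ∈ Finset.range (n+1), wtM hα hβ ((poch (-(n : ℝ)) l * poch ((n : ℝ) + (α+1) + (β+1) + 1) l /
        (poch (α + 1 + 1) l * (Nat.factorial l))) • (X^1 * (1 - X : ℝ[X]) ^ (l+m+1)))
      = (K * (β+1) * (α+1) / poch s (n+1)) * ((-1:ℝ)^l * (n.choose l : ℝ) * P.eval (l:ℝ)) := by
    intro l hl
    have hl' : l ≤ n := by have := Finset.mem_range.1 hl; omega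
    rw [map_smul, wtM_moment, poch_neg n l hl', smul_eq_mul, hP, eval_mul, pochPoly_eval,
      pochPoly_eval]
    have f1 : poch (β+1) 1 = β+1 := by simp [poch]
    have f2 : poch (α+1) (l+m+1) = (α+1) * (poch (α+1+1) l * poch (α+2+l) m) := by
      rw [show l+m+1 = 1 + (l+m) by ring, poch_add, poch_add]
      simp only [Nat.cast_one]
      rw [show α+1+1 = α+2 by ring]
      simp [poch]
    have f3 : poch s (n+1) * poch (n + (α+1) + (β+1) + 1) l
        = poch s (1+(l+m+1)) * poch (s+m+2+l) d := by
      have g1 := poch_add s (n+1) l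
      have g2 := poch_add s (1+(l+m+1)) d
      rw [show n+1+l = 1+(l+m+1)+d by omega, g2] at g1
      rw [show (n:ℝ) + (α+1)+(β+1)+1 = s + ((n+1:ℕ):ℝ) by push_cast; rw [hs]; ring, ← g1]
      congr 2; push_cast; ring
    have p1 := (poch_pos (show 0 < α+1+1 by linarith) l).ne'
    have p2 := (poch_pos s0 (n+1)).ne'
    have p3 := (poch_pos s0 (1+(l+m+1))).ne'
    have p4 : (l.factorial:ℝ) ≠ 0 := by positivity
    rw [f1, f2]
    have f4 : poch (n + (α+1) + (β+1) + 1) l = poch s (1+(l+m+1)) * poch (s+m+2+l) d / poch s (n+1) := by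
      rw [eq_div_iff p2, ← f3]; ring
    rw [f4, ← hs, ← hK]
    field_simp
  rw [Finset.sum_congr rfl e2, ← Finset.mul_sum, altsum_zero' P n hPd]
  simp

lemma sub_natDegree_le {p q : ℝ[X]} {n : ℕ} (hp : p.natDegree ≤ n) (hq : q.natDegree ≤ n) :
    (p - q).natDegree ≤ n :=
  (natDegree_sub_le p q).trans (max_le hp hq)

/-- The second-order operator on the left-hand side. -/
noncomputable def odeOp (n i : ℕ) (α β : ℝ) (y : ℝ[X]) : ℝ[X] :=
  X * (X - 1) * derivative (derivative y)
    + (C ((n:ℝ)+α+β+4) * X - C ((i:ℝ) + β + 2)) * derivative y + C ((n:ℝ)+α+β+2) * y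

lemma odeOp_identity (n i : ℕ) (α β : ℝ) (y p : ℝ[X]) :
    X * (1-X) * (p * odeOp n i α β y)
      = pearson α β ((X * (1-X) * derivative p + ((n:ℝ[X]) * X - (i:ℝ[X])) * p) * y)
        - pearson α β (X * (1-X) * p * derivative y)
        + y * (-(X * (1-X)) * derivative (pearson α β p)
            + ((i:ℝ[X]) - (n:ℝ[X]) * X) * pearson α β p) := by
  simp only [odeOp, pearson, derivative_add, derivative_sub, derivative_mul, derivative_X,
    derivative_C, derivative_one, derivative_natCast, derivative_ofNat, C_add, map_natCast, C_1, map_ofNat]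
  ring

lemma odeOp_orth {α β : ℝ} (hα : -1 < α) (hβ : -1 < β) (n i : ℕ) (y : ℝ[X])
    (hy : ∀ j, j ≤ n → j ≠ i → wtM hα hβ (X^j * (1-X)^(n-j) * y) = 0)
    (p : ℝ[X]) (hp : p.natDegree < n) :
    wtM hα hβ (X * (1-X) * (p * odeOp n i α β y)) = 0 := by
  rw [odeOp_identity, map_add, map_sub, wtM_pearson, wtM_pearson, sub_zero, zero_add]
  let T : ℝ[X] →ₗ[ℝ] ℝ[X] :=
    { toFun := fun q => y * (-(X * (1-X)) * derivative q + ((i:ℝ[X]) - (n:ℝ[X]) * X) * q)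
      map_add' := fun a b => by simp only [derivative_add]; ring
      map_smul' := fun c a => by
        simp only [smul_eq_C_mul, derivative_C_mul, RingHom.id_apply]; ring }
  refine bernstein_span n ((wtM hα hβ).comp T) ?_ (pearson α β p) ?_
  · intro j hj
    have e : T (X^j * (1-X)^(n-j)) = ((i:ℝ) - j) • (X^j * (1-X)^(n-j) * y) := by
      simp only [T, LinearMap.coe_mk, AddHom.coe_mk, derivative_mul, smul_eq_C_mul, C_sub,
        map_natCast]
      have h1 := X_mul_derivative_X_pow j
      have h2 := one_sub_mul_derivative_pow (n-j)
      rw [Nat.cast_sub hj] at h2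
      linear_combination (-y * (1-X) * (1-X)^(n-j)) * h1 - y * X * X^j * h2
    rw [LinearMap.comp_apply, e, map_smul]
    by_cases h : j = i
    · simp [h]
    · rw [hy j hj h, smul_zero]
  · rw [pearson]
    refine natDegree_add_le_of_degree_le ?_ ?_
    · by_cases h0 : p.natDegree = 0
      · rw [natDegree_eq_zero] at h0
        obtain ⟨c, rfl⟩ := h0
        simp
      · have h1 := natDegree_derivative_lt h0
        have h2 : (X * (1-X) : ℝ[X]).natDegree ≤ 2 := by compute_degree
        exact natDegree_mul_le.trans (by omega)
    · have h2 : (C (β+1) - C (α+β+2) * X : ℝ[X]).natDegree ≤ 1 := by compute_degree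
      exact natDegree_mul_le.trans (by omega)

lemma coeff_X_mul_derivative (p : ℝ[X]) (n : ℕ) :
    (X * derivative p).coeff n = n * p.coeff n := by
  cases n with
  | zero => simp
  | succ n => rw [coeff_X_mul, coeff_derivative]; push_cast; ring

lemma odeOp_coeff (n i : ℕ) (α β : ℝ) (y : ℝ[X]) (hy : y.natDegree ≤ n) :
    (odeOp n i α β y).coeff n = ((n:ℝ)+1) * (2*n+α+β+2) * y.coeff n := by
  have e : odeOp n i α β y = X * derivative (X * derivative y) - X * derivative y
      - X * derivative (derivative y) + C ((n:ℝ)+α+β+4) * (X * derivative y)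
      - C ((i:ℝ) + β + 2) * derivative y + C ((n:ℝ)+α+β+2) * y := by
    simp only [odeOp, derivative_mul, derivative_X]; ring
  have h : y.coeff (n+1) = 0 := coeff_eq_zero_of_natDegree_lt (by omega)
  rw [e]
  simp only [coeff_add, coeff_sub, coeff_C_mul, coeff_X_mul_derivative, coeff_derivative, h]
  ring

lemma natDegree_lt_of_coeff {r : ℝ[X]} {n : ℕ} (h : r.natDegree ≤ n) (hc : r.coeff n = 0)
    (hr : r ≠ 0) : r.natDegree < n := by
  refine lt_of_le_of_ne h fun he => hr ?_
  rw [← leadingCoeff_eq_zero, leadingCoeff, he, hc]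

lemma odeOp_natDegree (n i : ℕ) (α β : ℝ) (y : ℝ[X]) (hy : y.natDegree ≤ n) :
    (odeOp n i α β y).natDegree ≤ n := by
  have hX : ∀ p : ℝ[X], p.natDegree ≤ n → (X * derivative p).natDegree ≤ n := by
    intro p hp
    rw [natDegree_le_iff_coeff_eq_zero] at hp ⊢
    intro N hN
    rw [coeff_X_mul_derivative, hp N hN, mul_zero]
  have hd : (derivative y).natDegree ≤ n := (natDegree_derivative_le y).trans (by omega)
  have e : odeOp n i α β y = X * derivative (X * derivative y) - X * derivative y
      - X * derivative (derivative y) + C ((n:ℝ)+α+β+4) * (X * derivative y)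
      - C ((i:ℝ) + β + 2) * derivative y + C ((n:ℝ)+α+β+2) * y := by
    simp only [odeOp, derivative_mul, derivative_X]; ring
  rw [e]
  refine natDegree_add_le_of_degree_le (sub_natDegree_le (natDegree_add_le_of_degree_le
    (sub_natDegree_le (sub_natDegree_le ?_ ?_) ?_) ?_) ?_) ?_
  · exact hX _ (hX _ hy)
  · exact hX _ hy
  · exact hX _ hd
  · exact (natDegree_C_mul_le _ _).trans (hX _ hy)
  · exact (natDegree_C_mul_le _ _).trans hd
  · exact (natDegree_C_mul_le _ _).trans hy

lemma lead_coeff {α β : ℝ} (hα : -1 < α) (hβ : -1 < β) (n i : ℕ) (hi : i ≤ n) (y : ℝ[X])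
    (hyd : y.natDegree ≤ n)
    (hy : ∀ j, j ≤ n → (n.choose j : ℝ) * wtM hα hβ (X^j * (1-X)^(n-j) * y)
      = if j = i then 1 else 0) :
    y.coeff n * (n.factorial * (Real.Gamma (α+1) * Real.Gamma (β+1) / Real.Gamma (α+β+2)) *
      (poch (α+1) (n-i) * poch (β+1) i)) = (-1)^(n-i) * poch (α+β+2) (n+n) := by
  set K := Real.Gamma (α+1) * Real.Gamma (β+1) / Real.Gamma (α+β+2) with hK
  set S : ℝ[X] := ∑ j ∈ Finset.range (n+1),
    ((-1:ℝ)^(n-j) * (n.choose j : ℝ) / (poch (β+1) j * poch (α+1) (n-j))) •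
      (X^j * (1-X)^(n-j)) with hS
  have pβ := fun j => (poch_pos (show 0 < β+1 by linarith) j).ne'
  have pα := fun j => (poch_pos (show 0 < α+1 by linarith) j).ne'
  have ps := fun j => (poch_pos (show 0 < α+β+2 by linarith) j).ne'
  have h1 : wtM hα hβ (S * y) = (-1)^(n-i) / (poch (β+1) i * poch (α+1) (n-i)) := by
    rw [hS, Finset.sum_mul, map_sum, Finset.sum_eq_single i]
    · have := hy i hi
      rw [if_pos rfl] at this
      rw [smul_mul_assoc, map_smul, smul_eq_mul]
      linear_combination (-1)^(n-i) / (poch (β+1) i * poch (α+1) (n-i)) * this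
    · intro j hj hji
      have := hy j (by have := Finset.mem_range.1 hj; omega)
      rw [if_neg hji] at this
      rw [smul_mul_assoc, map_smul, smul_eq_mul]
      linear_combination (-1)^(n-j) / (poch (β+1) j * poch (α+1) (n-j)) * this
    · intro h; exact absurd (Finset.mem_range.2 (by omega)) h
  have h2 : ∀ a, wtM hα hβ (S * X^a) = K / poch (α+β+2) (n+a) *
      ∑ j ∈ Finset.range (n+1), (-1:ℝ)^(n-j) * (n.choose j : ℝ) * (pochPoly (β+1) a).eval (j:ℝ) := by
    intro a
    rw [hS, Finset.sum_mul, map_sum, Finset.mul_sum]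
    refine Finset.sum_congr rfl fun j hj => ?_
    have hj' : j ≤ n := by have := Finset.mem_range.1 hj; omega
    have e : (X^j * (1-X)^(n-j) * X^a : ℝ[X]) = X^(j+a) * (1-X)^(n-j) := by ring
    rw [smul_mul_assoc, map_smul, smul_eq_mul, e, wtM_moment, ← hK, pochPoly_eval, poch_add,
      show j + a + (n-j) = n + a by omega]
    have := pβ j
    have := pα (n-j)
    have := ps (n+a)
    field_simp
  have h3 : wtM hα hβ (S * y) = y.coeff n * (K / poch (α+β+2) (n+n) * n.factorial) := by
    conv_lhs => rw [y.as_sum_range' (n+1) (by omega)]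
    rw [Finset.mul_sum, map_sum, Finset.sum_range_succ, Finset.sum_eq_zero, zero_add,
      ← smul_X_eq_monomial, mul_smul_comm, map_smul, h2,
      altsum_fact _ _ (pochPoly_monic _ _) (pochPoly_natDegree _ _), smul_eq_mul]
    intro a ha
    rw [← smul_X_eq_monomial, mul_smul_comm, map_smul, h2, altsum_zero _ _ (by
      rw [pochPoly_natDegree]; exact Finset.mem_range.1 ha)]
    simp
  rw [h3] at h1
  have := pβ i
  have := pα (n-i)
  have := ps (n+n)
  field_simp at h1
  linear_combination h1

/-- Second-order non-homogeneous differential equation for dual Bernstein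
polynomials (Theorem 4.1 of the paper). -/
theorem dualBernstein_nonhomogeneous_ode (n : ℕ) (α β : ℝ) (hα : α > -1) (hβ : β > -1)
    (D : ℕ → Polynomial ℝ) (hD : IsDualBernstein n α β D)
    (i : ℕ) (hi : i ≤ n) (x : ℝ) :
    x*(x-1) * (Polynomial.derivative (Polynomial.derivative (D i))).eval x
      + (((n:ℝ)+α+β+4)*x - i - β - 2) * (Polynomial.derivative (D i)).eval x
      + ((n:ℝ)+α+β+2) * (D i).eval x
      = ((n:ℝ)+α+β+2) * ((-1)^(n-i) * ((n:ℝ)+1) * poch (α+β+2) n /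
      ((Real.Gamma (α+1) * Real.Gamma (β+1) / Real.Gamma (α+β+2)) * poch (α+1) (n-i) * poch (β+1) i)) * jacobiR (α+1) (β+1) n x := by
  obtain ⟨hdeg, hbi⟩ := hD
  have hyd := hdeg i hi
  have hy : ∀ j, j ≤ n → (n.choose j : ℝ) * wtM hα hβ (X^j * (1-X)^(n-j) * D i)
      = if j = i then 1 else 0 := by
    intro j hj
    rw [← hbi j hj i hi, wtM_apply, ← intervalIntegral.integral_const_mul]
    refine intervalIntegral.integral_congr fun t _ => ?_
    simp [bern]; ring
  have hlead := lead_coeff hα hβ n i hi (D i) hyd hy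
  set c : ℝ := ((n:ℝ)+α+β+2) * ((-1)^(n-i) * ((n:ℝ)+1) * poch (α+β+2) n /
      ((Real.Gamma (α+1) * Real.Gamma (β+1) / Real.Gamma (α+β+2)) * poch (α+1) (n-i) * poch (β+1) i)) with hc
  have main : odeOp n i α β (D i) - C c * jacP (α+1) (β+1) n = 0 := by
    set r := odeOp n i α β (D i) - C c * jacP (α+1) (β+1) n with hr
    by_contra hr0
    have hrd : r.natDegree ≤ n := sub_natDegree_le (odeOp_natDegree n i α β _ hyd)
      ((natDegree_C_mul_le _ _).trans (jacP_natDegree _ _ _))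
    have hrc : r.coeff n = 0 := by
      rw [hr, coeff_sub, odeOp_coeff _ _ _ _ _ hyd, coeff_C_mul, jacP_coeff _ _ (by linarith), hc]
      set K := Real.Gamma (α+1) * Real.Gamma (β+1) / Real.Gamma (α+β+2) with hK
      have hK0 : K ≠ 0 := by
        have := Real.Gamma_pos_of_pos (show 0 < α+1 by linarith)
        have := Real.Gamma_pos_of_pos (show 0 < β+1 by linarith)
        have := Real.Gamma_pos_of_pos (show 0 < α+β+2 by linarith)
        positivity
      have pβ := (poch_pos (show 0 < β+1 by linarith) i).ne'
      have pα := (poch_pos (show 0 < α+1 by linarith) (n-i)).ne'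
      have pf : (n.factorial : ℝ) ≠ 0 := by positivity
      have hp : poch (α+β+2) (n+n) * (2*n+α+β+2)
          = poch (α+β+2) n * ((n:ℝ)+α+β+2) * poch (n+(α+1)+(β+1)+1) n := by
        have g1 := poch_succ (α+β+2) (n+n)
        have g2 := poch_add (α+β+2) (n+1) n
        rw [show n+1+n = n+n+1 by ring, g1, poch_succ] at g2
        rw [show (n:ℝ)+(α+1)+(β+1)+1 = α+β+2+((n+1:ℕ):ℝ) by push_cast; ring]
        push_cast at g2 ⊢
        linear_combination g2
      have hl : (D i).coeff n = (-1)^(n-i) * poch (α+β+2) (n+n) /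
          (n.factorial * K * (poch (α+1) (n-i) * poch (β+1) i)) := by
        rw [eq_div_iff (by positivity), hlead]
      rw [hl]
      field_simp
      linear_combination (-1)^(n-i) * ((n:ℝ)+1) * hp
    have hlt := natDegree_lt_of_coeff hrd hrc hr0
    refine hr0 (wtM_pos hα hβ r ?_)
    have h1 := odeOp_orth hα hβ n i (D i) (fun j hj hji => by
      have := hy j hj
      rw [if_neg hji] at this
      have hch : (n.choose j : ℝ) ≠ 0 := by exact_mod_cast (Nat.choose_pos hj).ne'
      exact (mul_eq_zero.1 this).resolve_left hch) r hlt
    have h2 := jacP_orth hα hβ n r hlt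
    have e : X * (1-X) * (r*r) = X * (1-X) * (r * odeOp n i α β (D i))
        - c • (X * (1-X) * (r * jacP (α+1) (β+1) n)) := by
      rw [smul_eq_C_mul]
      linear_combination X * (1-X) * r * hr
    rw [e, map_sub, map_smul, h1, h2]; simp
  have := congrArg (Polynomial.eval x) main
  simp only [odeOp, eval_sub, eval_add, eval_mul, eval_X, eval_C, eval_one, eval_zero,
    jacP_eval] at this
  linear_combination this
end

section
/- For 0 ≤ i ≤ n, the dual Bernstein polynomial y(x) = D^n_i(x; α, β) satisfies the fourth-order homogeneous differential equation Σ_{j=0}^{4} w_j(x) y^{(j)}(x) = 0, with w_4(x) = x²(x-1)², w_3(x) = x(x-1)[(n+2σ+10)x - i - 2β - 6], w_2(x) = [(n+σ+3)(σ-n+7)+σ+3]x² + [(n-1)² + αn - 2β - (σ+3)(i+2β+8) - 5]x + (β+2)(i+β+3), w_1(x) = -(n+σ+2)[(n² + (n-2)(σ+3))x + (2-n)(i+β+2) - 2i], w_0(x) = -n(n+σ+1)(n+σ+2), where σ = α+β+1. -/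
open scoped BigOperators
open MeasureTheory Polynomial

lemma coef0 (m n a b : ℝ) :
  m*(m-1)*(m-2)*(m-3) + (n+2*(a+b+1)+10)*(m*(m-1)*(m-2)) + ((n+(a+b+1)+3)*((a+b+1)-n+7)+(a+b+1)+3)*(m*(m-1))
   + -(n+(a+b+1)+2)*(n^2+(n-2)*((a+b+1)+3))*m + -n*(n+(a+b+1)+1)*(n+(a+b+1)+2) = (m+1)*(m-n)*((a+b+1+m+n+1)*(a+b+1+m+n+2)) := by ring
lemma coef1 (m n i a b : ℝ) :
  -2*((m+1)*m*(m-1)*(m-2)) + (-(n+2*(a+b+1)+10) - i - 2*b-6)*((m+1)*m*(m-1)) + ((n-1)^2 + a*n - 2*b - ((a+b+1)+3)*(i+2*b+8) - 5)*((m+1)*m)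
   + -(n+(a+b+1)+2)*((2-n)*(i+b+2)-2*i)*(m+1)  = (m+1)*(n*(m+1)+((b+n+2)*(b+i+1)-(b+1)*(b+2+i))-(m+1)*(2*(m+1)-1+(b+1)+(b+2+i)))*(a+b+1+m+n+2) := by ring
lemma coef2 (m i b : ℝ) :
  ((m+2)*(m+1)*m*(m-1)) + (i+2*b+6)*((m+2)*(m+1)*m) + (b+2)*(i+b+3)*((m+2)*(m+1))
    = (m+1)*((m+2)*(m+1+(b+1))*(m+1+(b+2+i))) := by ring

lemma poch_eq (c : ℝ) (l : ℕ) : poch c l = (ascPochhammer ℝ l).eval c := by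
  induction l with
  | zero => simp [poch]
  | succ l ih => rw [ascPochhammer_succ_eval, ← ih, poch, Finset.prod_range_succ, ← poch]

lemma poch_pred (c : ℝ) (l : ℕ) : poch (c-1) (l+1) = (c - 1) * poch c l := by
  rw [poch, Finset.prod_range_succ', mul_comm]
  simp [poch]

/-- A combination of Pochhammer symbols vanishing at enough points is trivial. -/
lemma poch_indep (N : ℕ) (q : ℕ → ℝ) (t : Finset ℝ) (ht : N < t.card)
    (h : ∀ s ∈ t, ∑ m ∈ Finset.range (N+1), q m * poch s m = 0) : ∀ m ≤ N, q m = 0 := by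
  set R : ℝ[X] := ∑ m ∈ Finset.range (N+1), C (q m) * ascPochhammer ℝ m with hR
  have hev : ∀ s, R.eval s = ∑ m ∈ Finset.range (N+1), q m * poch s m := by
    intro s; simp [hR, eval_finsetSum, poch_eq]
  have hdeg : R.natDegree ≤ N := by
    apply natDegree_sum_le_of_forall_le
    intro m hm
    refine (natDegree_C_mul_le _ _).trans ?_
    rw [ascPochhammer_natDegree]
    simp at hm; omega
  have hR0 : R = 0 := by
    apply Polynomial.eq_zero_of_natDegree_lt_card_of_eval_eq_zero' R t
    · intro s hs; rw [hev]; exact h s hs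
    · omega
  intro m
  induction m using Nat.strong_induction_on with
  | _ m ih =>
    intro hm
    have h1 := hev (-(m:ℝ))
    rw [hR0, eval_zero, Finset.sum_eq_single m] at h1
    · rcases mul_eq_zero.mp h1.symm with h2 | h2
      · exact h2
      · exfalso
        rw [poch, Finset.prod_eq_zero_iff] at h2
        obtain ⟨j, hj, hj2⟩ := h2
        have : (j:ℝ) = m := by linarith
        have : j = m := by exact_mod_cast this
        simp at hj; omega
    · intro j hj hjm
      rcases lt_or_gt_of_ne hjm with h2 | h2
      · rw [ih j h2 (by omega)]; simp
      · rw [poch_eq, ascPochhammer_eval_neg_coe_nat_of_lt h2, mul_zero]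
    · intro h2; simp at h2; omega

lemma poch_expand (n : ℕ) (b : ℕ → ℝ) (hb : ∀ m, n < m → b m = 0) (u v u' v' s : ℝ)
    (huv : u + v = u' + v' + n)  :
    (∑ m ∈ Finset.range (n+1), b m * poch s m) * ((s-u)*(s-v))
      - (∑ m ∈ Finset.range (n+1), b m * poch (s-1) m) * ((s-u')*(s-v'))
    = ∑ m ∈ Finset.range (n+1+1), ((if m = 0 then 0 else ((m:ℝ)-1-n) * b (m-1))
        + (n*m + (u*v-u'*v') - m*(2*m-1+u'+v')) * b m
        + (m+1)*(m+u')*(m+v') * b (m+1)) * poch s m := by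
  simp only [add_mul (_ + _) _ (poch _ _), add_mul (ite _ _ _) _ (poch _ _), Finset.sum_add_distrib]
  have e1 : ∑ m ∈ Finset.range (n+1+1), (if m = 0 then 0 else ((m:ℝ)-1-n) * b (m-1)) * poch s m
    = ∑ m ∈ Finset.range (n+1), ((m:ℝ)-n) * b m * poch s (m+1) := by
    rw [Finset.sum_range_succ']
    simp
  have e2 : ∑ m ∈ Finset.range (n+1+1),
      ((n:ℝ)*m + (u*v-u'*v') - m*(2*m-1+u'+v')) * b m * poch s m
    = ∑ m ∈ Finset.range (n+1), ((n:ℝ)*m + (u*v-u'*v') - m*(2*m-1+u'+v')) * b m * poch s m := by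
    rw [Finset.sum_range_succ, hb (n+1) (by omega)]
    simp
  have e3 : ∑ m ∈ Finset.range (n+1+1), ((m:ℝ)+1)*(m+u')*(m+v') * b (m+1) * poch s m
    = ∑ m ∈ Finset.range (n+1), (m:ℝ)*(m-1+u')*(m-1+v') * b m * poch s (m-1) := by
    rw [Finset.sum_range_succ, Finset.sum_range_succ, hb (n+1) (by omega), hb (n+1+1) (by omega),
      Finset.sum_range_succ']
    simp
  rw [e1, e2, e3]
  rw [Finset.sum_mul, Finset.sum_mul, ← Finset.sum_sub_distrib, ← Finset.sum_add_distrib, ← Finset.sum_add_distrib]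
  apply Finset.sum_congr rfl
  intro m _
  obtain rfl : v = u' + v' + n - u := by linarith
  rcases m with _ | m
  · simp [poch_zero, poch_succ]; ring
  · rw [poch_pred]
    simp only [poch_succ, Nat.add_sub_cancel]
    push_cast
    ring

/-- The three-term recurrence from the zero pattern. -/
lemma b_rec (n i : ℕ) (hi : i ≤ n) (β : ℝ) (b : ℕ → ℝ) (hb : ∀ m, n < m → b m = 0)
    (h : ∀ k ≤ n, k ≠ i → ∑ m ∈ Finset.range (n+1), b m * poch (β+k+1) m = 0) (m : ℕ) :
    ((m:ℝ)-n) * b m + (n*(m+1) + ((β+n+2)*(β+i+1)-(β+1)*(β+2+i))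
        - (m+1)*(2*(m+1)-1+(β+1)+(β+2+i))) * b (m+1)
      + (m+2)*(m+1+(β+1))*(m+1+(β+2+i)) * b (m+2) = 0 := by
  rcases lt_or_ge n m with hm | hm
  · rw [hb m hm, hb (m+1) (by omega), hb (m+2) (by omega)]; ring
  have key := poch_indep (n+1) (fun m => ((if m = 0 then 0 else ((m:ℝ)-1-n) * b (m-1))
        + (n*m + ((β+n+2)*(β+i+1)-(β+1)*(β+2+i)) - m*(2*m-1+(β+1)+(β+2+i))) * b m
        + (m+1)*(m+(β+1))*(m+(β+2+i)) * b (m+1)))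
     ((Finset.range (n+2)).image (fun k : ℕ => β + k + 1)) ?_ ?_ (m+1) (by omega)
  · simp at key
    rw [← key]; ring_nf
  · rw [Finset.card_image_of_injective]
    · simp
    · intro x y hxy; simpa using hxy
  · intro s hs
    rw [← poch_expand n b hb _ _ _ _ s (by ring)]
    simp only [Finset.mem_image, Finset.mem_range] at hs
    obtain ⟨k, hk, rfl⟩ := hs
    have A : (∑ m ∈ Finset.range (n+1), b m * poch (β+k+1) m) * ((β+k+1-(β+n+2))*(β+k+1-(β+i+1))) = 0 := by
      by_cases h1 : k = i
      · subst h1; ring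
      by_cases h2 : k = n+1
      · subst h2; push_cast; ring
      rw [h k (by omega) h1]; ring
    have B : (∑ m ∈ Finset.range (n+1), b m * poch (β+k+1-1) m) * ((β+k+1-(β+1))*(β+k+1-(β+2+i))) = 0 := by
      rcases k with _ | k
      · simp
      by_cases h1 : k = i
      · subst h1; push_cast; ring
      have := h k (by omega) h1
      rw [show β + ((k+1:ℕ):ℝ) + 1 - 1 = β + k + 1 by push_cast; ring, this]; ring
    rw [A, B, sub_zero]

lemma beta_int (u v : ℝ) (hu : 0 < u) (hv : 0 < v) :
    IntervalIntegrable (fun x : ℝ => x ^ (u-1) * (1-x)^(v-1)) volume 0 1 ∧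
    ∫ x in (0:ℝ)..1, x ^ (u-1) * (1-x)^(v-1) = Real.Gamma u * Real.Gamma v / Real.Gamma (u+v) := by
  have hE : ∀ x ∈ Set.uIoc (0:ℝ) 1, ((x : ℂ) ^ ((u:ℂ) - 1) * (1 - (x : ℂ)) ^ ((v:ℂ) - 1))
      = ((x ^ (u-1) * (1-x)^(v-1) : ℝ) : ℂ) := by
    intro x hx
    rw [Set.uIoc_of_le zero_le_one] at hx
    rw [Complex.ofReal_mul, Complex.ofReal_cpow hx.1.le, Complex.ofReal_cpow (by linarith [hx.2])]
    push_cast; rfl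
  have hc := Complex.betaIntegral_convergent (u := u) (v := v) (by simpa) (by simpa)
  have hc' : IntervalIntegrable (fun x : ℝ => ((x ^ (u-1) * (1-x)^(v-1) : ℝ) : ℂ)) volume 0 1 :=
    hc.congr hE
  constructor
  · have := hc'.1.re
    refine ⟨?_, by simp⟩
    simpa [IntegrableOn] using this
  · have h1 := ProbabilityTheory.beta_eq_betaIntegralReal u v hu hv
    rw [ProbabilityTheory.beta] at h1
    rw [h1, Complex.betaIntegral, intervalIntegral.integral_congr_ae (Filter.Eventually.of_forall hE)]
    rw [intervalIntegral.integral_ofReal, Complex.ofReal_re]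

lemma poch_gamma (s : ℝ) (hs : 0 < s) (m : ℕ) : Real.Gamma (s + m) = poch s m * Real.Gamma s := by
  induction m with
  | zero => simp [poch]
  | succ m ih =>
    rw [poch, Finset.prod_range_succ, ← poch]
    push_cast
    rw [← add_assoc, Real.Gamma_add_one (by positivity), ih]; ring

lemma moment (n : ℕ) (α β : ℝ) (hα : α > -1) (hβ : β > -1) (p : ℝ[X]) (hp : p.natDegree ≤ n)
    (k : ℕ) (hk : k ≤ n) (h : (∫ x in (0:ℝ)..1, (1 - x) ^ α * x ^ β * bern n k x * p.eval x) = 0) :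
    ∑ m ∈ Finset.range (n+1), (p.coeff m / Real.Gamma (α+β+n+2+m)) * poch (β+k+1) m = 0 := by
  have hbm : ∀ m : ℕ, 0 < β + k + 1 + m := fun m => by
    have : (0:ℝ) ≤ k := by positivity
    have : (0:ℝ) ≤ m := by positivity
    linarith
  have hb0 : 0 < β + k + 1 := by simpa using hbm 0
  have ha : 0 < α + (n-k:ℕ) + 1 := by
    have : (0:ℝ) ≤ (n-k:ℕ) := by positivity
    linarith
  have hE : ∀ x ∈ Set.Ioo (0:ℝ) 1, (1 - x) ^ α * x ^ β * bern n k x * p.eval x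
     = ∑ m ∈ Finset.range (n+1), ((n.choose k : ℝ) * p.coeff m) *
        (x ^ ((β+k+1+m) - 1) * (1-x) ^ ((α+(n-k:ℕ)+1)-1)) := by
    intro x hx
    rw [Polynomial.eval_eq_sum_range' (n := n+1) (by omega), Finset.mul_sum]
    apply Finset.sum_congr rfl
    intro m _
    have h1 : 0 < 1 - x := by linarith [hx.2]
    rw [show (β+k+1+m) - 1 = β + k + m by ring, show (α+(n-k:ℕ)+1)-1 = α + (n-k:ℕ) by ring,
      Real.rpow_add hx.1, Real.rpow_add hx.1, Real.rpow_add h1]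
    simp only [Real.rpow_natCast, bern]
    ring
  rw [intervalIntegral.integral_of_le zero_le_one, MeasureTheory.integral_Ioc_eq_integral_Ioo,
    MeasureTheory.setIntegral_congr_fun measurableSet_Ioo hE,
    ← MeasureTheory.integral_Ioc_eq_integral_Ioo, ← intervalIntegral.integral_of_le zero_le_one,
    intervalIntegral.integral_finsetSum
      (fun m _ => ((beta_int _ _ (hbm m) ha).1.const_mul _))] at h
  have hc : (n.choose k : ℝ) * Real.Gamma (β+k+1) * Real.Gamma (α+(n-k:ℕ)+1) ≠ 0 := by
    have := Nat.choose_pos hk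
    have h1 := Real.Gamma_pos_of_pos hb0
    have h2 := Real.Gamma_pos_of_pos ha
    positivity
  apply (mul_eq_zero.mp (?_ : _ * _ = (0:ℝ))).resolve_left hc
  rw [← h, Finset.mul_sum]
  apply Finset.sum_congr rfl
  intro m _
  rw [intervalIntegral.integral_const_mul, (beta_int _ _ (hbm m) ha).2, poch_gamma _ hb0,
    show β+k+1+m+(α+(n-k:ℕ)+1) = α+β+n+2+m by push_cast [Nat.cast_sub hk]; ring]
  ring

/-- Coefficients of `X^j * p^(k)`. -/
lemma cdgen (p : ℝ[X]) (k j d : ℕ) (hk : k = j + d) (m : ℕ) :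
    (X^j * derivative^[k] p).coeff m = (∏ r ∈ Finset.range k, ((m:ℝ) + d - r)) * p.coeff (m+d) := by
  subst hk
  rw [coeff_X_pow_mul']
  split_ifs with h
  · rw [coeff_iterate_derivative, show m - j + (j+d) = m + d by omega, nsmul_eq_mul,
      Nat.descFactorial_eq_prod_range]
    push_cast
    congr 1
    apply Finset.prod_congr rfl
    intro r hr
    simp at hr
    rw [Nat.cast_sub (by omega)]; push_cast; ring
  · rw [Finset.prod_eq_zero (i := m+d) (by simp; omega) (by push_cast; ring), zero_mul]

/-- Fourth-order homogeneous differential equation for dual Bernstein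
polynomials (with σ = α+β+1). -/
theorem dualBernstein_fourth_order_ode (n : ℕ) (α β : ℝ) (hα : α > -1) (hβ : β > -1)
    (D : ℕ → Polynomial ℝ) (hD : IsDualBernstein n α β D)
    (i : ℕ) (hi : i ≤ n) (x : ℝ) :
    (x^2*(x-1)^2) * (Polynomial.derivative^[4] (D i)).eval x
      + (x*(x-1)*(((n:ℝ)+2*(α+β+1)+10)*x - i - 2*β - 6)) *
          (Polynomial.derivative^[3] (D i)).eval x
      + ((((n:ℝ)+(α+β+1)+3)*((α+β+1)-(n:ℝ)+7)+(α+β+1)+3)*x^2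
          + (((n:ℝ)-1)^2 + α*(n:ℝ) - 2*β - ((α+β+1)+3)*((i:ℝ)+2*β+8) - 5)*x
          + (β+2)*((i:ℝ)+β+3)) *
          (Polynomial.derivative^[2] (D i)).eval x
      + (-((n:ℝ)+(α+β+1)+2)*(((n:ℝ)^2+((n:ℝ)-2)*((α+β+1)+3))*x
          + (2-(n:ℝ))*((i:ℝ)+β+2) - 2*i)) *
          (Polynomial.derivative (D i)).eval x
      + (-(n:ℝ)*((n:ℝ)+(α+β+1)+1)*((n:ℝ)+(α+β+1)+2)) * (D i).eval x
      = 0 := by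
  obtain ⟨hdeg, hint⟩ := hD
  set p := D i with hp
  set G : ℕ → ℝ := fun m => Real.Gamma (α+β+n+2+m) with hG
  have hpos : ∀ m : ℕ, 0 < α+β+n+2+m := fun m => by
    have : (0:ℝ) ≤ n := by positivity
    have : (0:ℝ) ≤ m := by positivity
    linarith
  have hG0 : ∀ m, G m ≠ 0 := fun m => (Real.Gamma_pos_of_pos (hpos m)).ne'
  have hGs : ∀ m, G (m+1) = (α+β+n+2+m) * G m := fun m => by
    simp only [hG]
    rw [← Real.Gamma_add_one (hpos m).ne']
    push_cast; congr 1; ring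
  have hrec := b_rec n i hi β (fun m => p.coeff m / G m)
    (fun m hm => by
      have h1 : p.natDegree ≤ n := hdeg i hi
      simp [coeff_eq_zero_of_natDegree_lt (lt_of_le_of_lt h1 hm)])
    (fun k hk hki => moment n α β hα hβ p (hdeg i hi) k hk (by rw [hint k hk i hi, if_neg hki]))
  have hcoef : ∀ m : ℕ,
      (m+1)*(m-n)*((α+β+1+m+n+1)*(α+β+1+m+n+2)) * p.coeff m
      + (m+1)*(n*(m+1)+((β+n+2)*(β+i+1)-(β+1)*(β+2+i))
          -(m+1)*(2*(m+1)-1+(β+1)+(β+2+i)))*(α+β+1+m+n+2) * p.coeff (m+1)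
      + (m+1)*((m+2)*(m+1+(β+1))*(m+1+(β+2+i))) * p.coeff (m+2) = 0 := by
    intro m
    have h := hrec m
    obtain ⟨b0, hb0⟩ : ∃ c, c = p.coeff m / G m := ⟨_, rfl⟩
    obtain ⟨b1, hb1⟩ : ∃ c, c = p.coeff (m+1) / G (m+1) := ⟨_, rfl⟩
    obtain ⟨b2, hb2⟩ : ∃ c, c = p.coeff (m+2) / G (m+2) := ⟨_, rfl⟩
    simp only [← hb0, ← hb1, ← hb2] at h
    rw [eq_div_iff (hG0 _)] at hb0 hb1 hb2
    rw [← hb0, ← hb1, ← hb2, hGs (m+1), hGs m]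
    push_cast
    linear_combination ((m+1)*((α+β+1+m+n+1)*(α+β+1+m+n+2)) * G m) * h
  have hpoly : C 1 * (X^4 * derivative^[4] p) + C (-2) * (X^3 * derivative^[4] p)
      + C 1 * (X^2 * derivative^[4] p)
      + C ((n:ℝ)+2*(α+β+1)+10) * (X^3 * derivative^[3] p)
      + C (-((n:ℝ)+2*(α+β+1)+10) - i - 2*β - 6) * (X^2 * derivative^[3] p)
      + C ((i:ℝ)+2*β+6) * (X^1 * derivative^[3] p)
      + C (((n:ℝ)+(α+β+1)+3)*((α+β+1)-(n:ℝ)+7)+(α+β+1)+3) * (X^2 * derivative^[2] p)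
      + C (((n:ℝ)-1)^2 + α*(n:ℝ) - 2*β - ((α+β+1)+3)*((i:ℝ)+2*β+8) - 5)
        * (X^1 * derivative^[2] p)
      + C ((β+2)*((i:ℝ)+β+3)) * (X^0 * derivative^[2] p)
      + C (-((n:ℝ)+(α+β+1)+2)*((n:ℝ)^2+((n:ℝ)-2)*((α+β+1)+3))) * (X^1 * derivative^[1] p)
      + C (-((n:ℝ)+(α+β+1)+2)*((2-(n:ℝ))*((i:ℝ)+β+2) - 2*i)) * (X^0 * derivative^[1] p)
      + C (-(n:ℝ)*((n:ℝ)+(α+β+1)+1)*((n:ℝ)+(α+β+1)+2)) * (X^0 * derivative^[0] p) = 0 := by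
    ext m
    simp only [coeff_add, coeff_C_mul, coeff_zero]
    rw [cdgen p 4 4 0 rfl, cdgen p 4 3 1 rfl, cdgen p 4 2 2 rfl, cdgen p 3 3 0 rfl,
      cdgen p 3 2 1 rfl, cdgen p 3 1 2 rfl, cdgen p 2 2 0 rfl, cdgen p 2 1 1 rfl,
      cdgen p 2 0 2 rfl, cdgen p 1 1 0 rfl, cdgen p 1 0 1 rfl, cdgen p 0 0 0 rfl]
    simp only [Finset.prod_range_succ, Finset.prod_range_zero, add_zero]
    push_cast
    linear_combination hcoef m + p.coeff m * coef0 m n α β + p.coeff (m+1) * coef1 m n i α β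
      + p.coeff (m+2) * coef2 m i β
  have hx := congrArg (eval x) hpoly
  simp only [eval_add, eval_mul, eval_C, eval_pow, eval_X, eval_zero, Function.iterate_one,
    Function.iterate_zero, id_eq] at hx
  linear_combination hx
end
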